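/- Let k ≥ 0, m,n ∈ ℕ, let x be any element of the A(S^7_q)-bimodule M = A(S^7_q) ⊗_B A(S^7_q), and set u = q^{2+m+n} z_1* x z_1 + q^{2+m+n} z_2 x z_2* + q^2 z_3 x z_3* + z_4* x z_4 and v = −q^3 z_1 x z_2* + q^2 z_2* x z_1 − q^k z_3* x z_4 + q^{1+k} z_4 x z_3* in M. Then the four relations (i) q^{−(m+n)} z_1 u + z_2 v = x z_1, (ii) −q^{−k} z_3 v + z_4 u = x z_4, (iii) −q z_1* v + q^{−(m+n)} z_2* u = x z_2*, (iv) z_3* u + q^{−(1+k)} z_4* v = x z_3* hold if and only if the four relations (i') (1 − q^2 R) x z_1 = q^{2−m−n} b_{m+n+k} x z_3* + q^{−m−n} a_{k+m+n} x z_4, (ii') R x z_4 = q^{2−k} b_{k+m+n} x z_2* + q^{2+m+n} (a_{−(m+n+k)})* x z_1, (iii') (1 − q^2 R) x z_2* = q^k (b_{−(m+n+k)})* x z_4 − q^{3+k} (a_{−(m+n+k)})* x z_3*, (iv') q^4 R x z_3* = q^{2+m+n} (b_{−(m+n+k)})* x z_1 − q^{3−k} a_{k+m+n} x z_2* hold.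 -/

import Mathlib

open scoped TensorProduct

noncomputable section

namespace QIB

/-- Generators of `A(U_q(4))`: the matrix entries `t i j` and the extra generator `D_q⁻¹`. -/
abbrev genU : Type := (Fin 4 × Fin 4) ⊕ Unit

abbrev FU : Type := FreeAlgebra ℂ genU

def T (i j : Fin 4) : FU := FreeAlgebra.ι ℂ (Sum.inl (i, j))

def Dinv0 : FU := FreeAlgebra.ι ℂ (Sum.inr ())

/-- The length (number of inversions) of a permutation of `Fin 4`. -/
def plen (σ : Equiv.Perm (Fin 4)) : ℕ :=
  ((Finset.univ : Finset (Fin 4 × Fin 4)).filter fun p => p.1 < p.2 ∧ σ p.2 < σ p.1).card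

/-- The quantum determinant, as an element of the free algebra. -/
def Dq0 (q : ℝ) : FU :=
  ∑ σ : Equiv.Perm (Fin 4),
    ((-(q : ℂ)) ^ plen σ) • (T (σ 0) 0 * T (σ 1) 1 * T (σ 2) 2 * T (σ 3) 3)

/-- The defining relations of `A(U_q(4))`. -/
inductive relU (q : ℝ) : FU → FU → Prop
  | col {i j k : Fin 4} : i < j → relU q (T i k * T j k) ((q : ℂ) • (T j k * T i k))
  | row {i j k : Fin 4} : i < j → relU q (T k i * T k j) ((q : ℂ) • (T k j * T k i))
  | comm {i j k l : Fin 4} : i < j → k < l → relU q (T i l * T j k) (T j k * T i l)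
  | qcom {i j k l : Fin 4} : i < j → k < l →
      relU q (T i k * T j l - T j l * T i k) (((q : ℂ) - (q : ℂ)⁻¹) • (T j k * T i l))
  | dr : relU q (Dq0 q * Dinv0) 1
  | dl : relU q (Dinv0 * Dq0 q) 1

variable (q : ℝ)

/-- The algebra `A(U_q(4))`. -/
abbrev AU : Type := RingQuot (relU q)

/-- The generators `t i j` of `A(U_q(4))` (indices are 0-based). -/
def tt (i j : Fin 4) : AU q := RingQuot.mkAlgHom ℂ (relU q) (T i j)

/-- The generator `D_q⁻¹`. -/
def dI : AU q := RingQuot.mkAlgHom ℂ (relU q) Dinv0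

/-- The quantum determinant `D_q` in `A(U_q(4))`. -/
def Dq : AU q := RingQuot.mkAlgHom ℂ (relU q) (Dq0 q)

/-- The spanning set `R` of relation elements (0-based indices). -/
def Rset : Set (AU q) :=
  {tt q 0 2, tt q 2 0, tt q 0 3, tt q 3 0, tt q 1 3, tt q 3 1, tt q 1 2, tt q 2 1,
   tt q 0 0 - tt q 3 3, tt q 0 1 + tt q 3 2, tt q 1 0 + tt q 2 3, tt q 1 1 - tt q 2 2,
   tt q 0 0 * tt q 1 1 - (q : ℂ) • (tt q 0 1 * tt q 1 0) - 1}

/-- The right ideal `ℛ = R · A(U_q(4))`, as a `ℂ`-submodule. -/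
def RIdeal : Submodule ℂ (AU q) :=
  Submodule.span ℂ {y | ∃ x ∈ Rset q, ∃ a : AU q, y = x * a}

/-- The coalgebra `C = A(U_q(4)) / ℛ`. -/
abbrev Cq : Type := AU q ⧸ RIdeal q

/-- The canonical projection `r : A(U_q(4)) → C`. -/
def rr : AU q →ₗ[ℂ] Cq q := (RIdeal q).mkQ

lemma RIdeal_mul_right {y : AU q} (hy : y ∈ RIdeal q) (c : AU q) : y * c ∈ RIdeal q := by
  induction hy using Submodule.span_induction with
  | mem x hx =>
      obtain ⟨x0, hx0, a, rfl⟩ := hx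
      exact Submodule.subset_span ⟨x0, hx0, a * c, by rw [mul_assoc]⟩
  | zero => simp
  | add u v _ _ hu hv => simpa [add_mul] using (RIdeal q).add_mem hu hv
  | smul a u _ hu => simpa [smul_mul_assoc] using (RIdeal q).smul_mem a hu

/-- Auxiliary map for the right `A(U_q(4))`-module structure of `C`:
right multiplication by `c` descends to the quotient. -/
def cactAux (c : AU q) : Cq q →ₗ[ℂ] Cq q :=
  Submodule.liftQ (RIdeal q) ((RIdeal q).mkQ ∘ₗ LinearMap.mulRight ℂ c)
    (by
      intro y hy
      simp only [LinearMap.mem_ker, LinearMap.comp_apply, LinearMap.mulRight_apply,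
        Submodule.mkQ_apply, Submodule.Quotient.mk_eq_zero]
      exact RIdeal_mul_right q hy c)

@[simp] lemma cactAux_mk (c a : AU q) :
    cactAux q c (Submodule.Quotient.mk a) = (Submodule.Quotient.mk (a * c) : Cq q) := by
  simp [cactAux]

/-- The right `A(U_q(4))`-module structure `r(t) · t' := r(t t')` of `C`,
as a bilinear map `A(U_q(4)) →ₗ C →ₗ C`, `(c, x) ↦ x · c`. -/
def cact : AU q →ₗ[ℂ] Cq q →ₗ[ℂ] Cq q where
  toFun c := cactAux q c
  map_add' c c' := by
    refine LinearMap.ext fun x => ?_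
    obtain ⟨a, rfl⟩ := Submodule.Quotient.mk_surjective _ x
    simp only [cactAux_mk, mul_add, Submodule.Quotient.mk_add, LinearMap.add_apply]
  map_smul' s c := by
    refine LinearMap.ext fun x => ?_
    obtain ⟨a, rfl⟩ := Submodule.Quotient.mk_surjective _ x
    simp only [cactAux_mk, mul_smul_comm, Submodule.Quotient.mk_smul, RingHom.id_apply, LinearMap.smul_apply]

@[simp] lemma cact_mk (c a : AU q) : cact q c (rr q a) = rr q (a * c) := by
  simp [cact, rr]

/-- θ(k) = 1 for k ≥ 0 and 0 for k < 0. -/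
def thetaZ (k : ℤ) : ℂ := if 0 ≤ k then 1 else 0

/-- The linear basis elements `r^{k,m,n}` of `C`, given as representatives in `A(U_q(4))`. -/
def bas (k : ℤ) (m n : ℕ) : AU q :=
  if 0 ≤ k then tt q 0 0 ^ k.toNat * tt q 0 1 ^ m * tt q 1 0 ^ n
  else tt q 0 1 ^ m * tt q 1 0 ^ n * tt q 1 1 ^ (-k).toNat

/-! ### The quantum seven-sphere -/

/-- Generators of `A(S⁷_q)`: `(i, false)` is `z_i`, `(i, true)` is `z_i^*`. -/
abbrev genS : Type := Fin 4 × Bool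

abbrev FS : Type := FreeAlgebra ℂ genS

def Z0 (i : Fin 4) : FS := FreeAlgebra.ι ℂ (i, false)

def Zs0 (i : Fin 4) : FS := FreeAlgebra.ι ℂ (i, true)

/-- The defining relations of the ∗-algebra `A(S⁷_q)` (including the ∗-conjugate of the
first family of relations, so that the relation set is closed under the involution). -/
inductive relS (q : ℝ) : FS → FS → Prop
  | zz {i j : Fin 4} : i < j → relS q (Z0 i * Z0 j) ((q : ℂ) • (Z0 j * Z0 i))
  | ss {i j : Fin 4} : i < j → relS q (Zs0 j * Zs0 i) ((q : ℂ) • (Zs0 i * Zs0 j))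
  | sz {i j : Fin 4} : i ≠ j → relS q (Zs0 j * Z0 i) ((q : ℂ) • (Z0 i * Zs0 j))
  | szz {k : Fin 4} : relS q (Zs0 k * Z0 k)
      (Z0 k * Zs0 k + (1 - (q : ℂ) ^ 2) •
        ∑ j ∈ Finset.univ.filter (· < k), Z0 j * Zs0 j)
  | sum1 : relS q (∑ k : Fin 4, Z0 k * Zs0 k) 1

/-- The algebra `P = A(S⁷_q)`. -/
abbrev PA : Type := RingQuot (relS q)

/-- The generators `z_i` of `A(S⁷_q)` (0-based index). -/
def z (i : Fin 4) : PA q := RingQuot.mkAlgHom ℂ (relS q) (Z0 i)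

/-- The generators `z_i^*` of `A(S⁷_q)` (0-based index). -/
def zs (i : Fin 4) : PA q := RingQuot.mkAlgHom ℂ (relS q) (Zs0 i)

/-- The element `R = z₁ z₁^* + z₂ z₂^*` of `A(S⁷_q)`. -/
def RRe [StarRing (PA q)] : PA q := z q 0 * star (z q 0) + z q 1 * star (z q 1)

/-- The element `a = z₁ z₄^* − z₂ z₃^*` of `A(S⁷_q)`. -/
def aa [StarRing (PA q)] : PA q := z q 0 * star (z q 3) - z q 1 * star (z q 2)

/-- The element `b = z₁ z₃ + q⁻¹ z₂ z₄` of `A(S⁷_q)`. -/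
def bb : PA q := z q 0 * z q 2 + (q : ℂ)⁻¹ • (z q 1 * z q 3)

/-- The elements `a_n = z₁ z₄^* − qⁿ z₂ z₃^*` of `A(S⁷_q)`. -/
def aN [StarRing (PA q)] (n : ℤ) : PA q :=
  z q 0 * star (z q 3) - ((q : ℂ) ^ n) • (z q 1 * star (z q 2))

/-- The elements `b_n = z₁ z₃ + q^{n−1} z₂ z₄` of `A(S⁷_q)`. -/
def bN (n : ℤ) : PA q := z q 0 * z q 2 + ((q : ℂ) ^ (n - 1)) • (z q 1 * z q 3)

/-! ### The coaction, the coinvariants and the canonical map -/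

variable (δ : PA q →ₐ[ℂ] PA q ⊗[ℂ] AU q)

/-- `Δ_r := (id ⊗ r) ∘ Δ : A(S⁷_q) → A(S⁷_q) ⊗ C`, built from the
`A(U_q(4))`-coaction `δ`. -/
def Dr : PA q →ₗ[ℂ] PA q ⊗[ℂ] Cq q :=
  (LinearMap.lTensor (PA q) (rr q)) ∘ₗ δ.toLinearMap

/-- The set of coinvariants `B = A(Σ⁴_q) = {a | Δ_r(a) = a ⊗ r(1)}`. -/
def Bset : Set (PA q) := {a : PA q | Dr q δ a = a ⊗ₜ[ℂ] rr q 1}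

/-- The subspace of `P ⊗ P` spanned by the elements `(u b) ⊗ v − u ⊗ (b v)` with `b`
a coinvariant; quotienting by it produces the balanced tensor product `P ⊗_B P`. -/
def relT : Submodule ℂ (PA q ⊗[ℂ] PA q) :=
  Submodule.span ℂ
    {x : PA q ⊗[ℂ] PA q | ∃ u v b : PA q, b ∈ Bset q δ ∧
      x = (u * b) ⊗ₜ[ℂ] v - u ⊗ₜ[ℂ] (b * v)}

set_option maxSynthPendingDepth 3

/-- The balanced tensor product `P ⊗_B P` over the coinvariant subalgebra `B = A(Σ⁴_q)`. -/
abbrev PBP : Type := (PA q ⊗[ℂ] PA q) ⧸ relT q δ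

/-- The canonical projection `P ⊗ P → P ⊗_B P`. -/
def mkT : PA q ⊗[ℂ] PA q →ₗ[ℂ] PBP q δ := (relT q δ).mkQ

lemma relT_map_lmul (p : PA q) {x : PA q ⊗[ℂ] PA q} (hx : x ∈ relT q δ) :
    TensorProduct.map (LinearMap.mulLeft ℂ p) LinearMap.id x ∈ relT q δ := by
  induction hx using Submodule.span_induction with
  | mem y hy =>
      obtain ⟨u, v, b, hb, rfl⟩ := hy
      refine Submodule.subset_span ⟨p * u, v, b, hb, ?_⟩
      simp [TensorProduct.map_tmul, mul_assoc]
  | zero => simp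
  | add u v _ _ hu hv => simpa [map_add] using Submodule.add_mem _ hu hv
  | smul a u _ hu => simpa [map_smul] using Submodule.smul_mem _ a hu

lemma relT_map_rmul (p : PA q) {x : PA q ⊗[ℂ] PA q} (hx : x ∈ relT q δ) :
    TensorProduct.map LinearMap.id (LinearMap.mulRight ℂ p) x ∈ relT q δ := by
  induction hx using Submodule.span_induction with
  | mem y hy =>
      obtain ⟨u, v, b, hb, rfl⟩ := hy
      refine Submodule.subset_span ⟨u, v * p, b, hb, ?_⟩
      simp [TensorProduct.map_tmul, mul_assoc]
  | zero => simp
  | add u v _ _ hu hv => simpa [map_add] using Submodule.add_mem _ hu hv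
  | smul a u _ hu => simpa [map_smul] using Submodule.smul_mem _ a hu

/-- Left multiplication by `p ∈ P` on the bimodule `P ⊗_B P`. -/
def lact (p : PA q) : PBP q δ →ₗ[ℂ] PBP q δ :=
  Submodule.liftQ (relT q δ)
    ((relT q δ).mkQ ∘ₗ TensorProduct.map (LinearMap.mulLeft ℂ p) LinearMap.id)
    (by
      intro x hx
      simp only [LinearMap.mem_ker, LinearMap.comp_apply, Submodule.mkQ_apply,
        Submodule.Quotient.mk_eq_zero]
      exact relT_map_lmul q δ p hx)

/-- Right multiplication by `p ∈ P` on the bimodule `P ⊗_B P`. -/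
def ract (p : PA q) : PBP q δ →ₗ[ℂ] PBP q δ :=
  Submodule.liftQ (relT q δ)
    ((relT q δ).mkQ ∘ₗ TensorProduct.map LinearMap.id (LinearMap.mulRight ℂ p))
    (by
      intro x hx
      simp only [LinearMap.mem_ker, LinearMap.comp_apply, Submodule.mkQ_apply,
        Submodule.Quotient.mk_eq_zero]
      exact relT_map_rmul q δ p hx)

/-- The structure map of the right action `◁` of `A(S⁷_q)` on `A(S⁷_q) ⊗ C`:
on simple tensors, `(u ⊗ x) ⊗ (w ⊗ y) ↦ (u w) ⊗ (x · y)`.  The action is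
`(u ⊗ x) ◁ v = triMap ((u ⊗ x) ⊗ δ v) = Σ u v₍₀₎ ⊗ x · v₍₁₎`. -/
def triMap : (PA q ⊗[ℂ] Cq q) ⊗[ℂ] (PA q ⊗[ℂ] AU q) →ₗ[ℂ] PA q ⊗[ℂ] Cq q :=
  (TensorProduct.map (LinearMap.mul' ℂ (PA q)) (TensorProduct.lift (LinearMap.flip (cact q)))) ∘ₗ
    (TensorProduct.tensorTensorTensorComm ℂ (PA q) (Cq q) (PA q) (AU q)).toLinearMap

/-- The left action on `P ⊗_B P` as an algebra map. -/
def lactHom : PA q →ₐ[ℂ] Module.End ℂ (PBP q δ) :=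
  AlgHom.ofLinearMap
    { toFun := fun p => lact q δ p
      map_add' := fun a b => by
        refine LinearMap.ext fun x => ?_
        obtain ⟨t, rfl⟩ := Submodule.Quotient.mk_surjective _ x
        induction t using TensorProduct.induction_on with
        | zero => simp
        | tmul c d =>
          simp [lact, add_mul, TensorProduct.add_tmul]
        | add c d hc hd => simp only [Submodule.Quotient.mk_add, map_add, hc, hd]
      map_smul' := fun s b => by
        refine LinearMap.ext fun x => ?_
        obtain ⟨t, rfl⟩ := Submodule.Quotient.mk_surjective _ x
        induction t using TensorProduct.induction_on with
        | zero => simp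
        | tmul c d =>
          simp [lact]
          rw [← TensorProduct.smul_tmul', Submodule.Quotient.mk_smul]
        | add c d hc hd => simp only [Submodule.Quotient.mk_add, map_add, hc, hd] }
    (by
      refine LinearMap.ext fun x => ?_
      obtain ⟨t, rfl⟩ := Submodule.Quotient.mk_surjective _ x
      induction t using TensorProduct.induction_on with
      | zero => simp
      | tmul c d => simp [lact]
      | add c d hc hd => simp only [Submodule.Quotient.mk_add, map_add, hc, hd])
    (fun a b => by
      refine LinearMap.ext fun x => ?_
      obtain ⟨t, rfl⟩ := Submodule.Quotient.mk_surjective _ x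
      induction t using TensorProduct.induction_on with
      | zero => simp
      | tmul c d => simp [lact, mul_assoc]
      | add c d hc hd => simp only [Submodule.Quotient.mk_add, map_add, hc, hd])

lemma lactHom_apply (p : PA q) : lact q δ p = lactHom q δ p := rfl

lemma z_zz {i j : Fin 4} (h : i < j) : z q i * z q j = (q : ℂ) • (z q j * z q i) := by
  simpa only [z, map_mul, map_smul] using RingQuot.mkAlgHom_rel ℂ (relS.zz (q := q) h)

lemma z_ss {i j : Fin 4} (h : i < j) : zs q j * zs q i = (q : ℂ) • (zs q i * zs q j) := by
  simpa only [zs, map_mul, map_smul] using RingQuot.mkAlgHom_rel ℂ (relS.ss (q := q) h)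

lemma z_sz {i j : Fin 4} (h : i ≠ j) : zs q j * z q i = (q : ℂ) • (z q i * zs q j) := by
  simpa only [z, zs, map_mul, map_smul] using RingQuot.mkAlgHom_rel ℂ (relS.sz (q := q) h)

lemma z_szz (k : Fin 4) : zs q k * z q k = z q k * zs q k + (1 - (q : ℂ) ^ 2) •
    ∑ j ∈ Finset.univ.filter (· < k), z q j * zs q j := by
  simpa only [z, zs, map_mul, map_add, map_smul, map_sum] using
    RingQuot.mkAlgHom_rel ℂ (relS.szz (q := q) (k := k))

lemma z_sum : z q 0 * zs q 0 + z q 1 * zs q 1 + z q 2 * zs q 2 + z q 3 * zs q 3 = 1 := by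
  simpa [z, zs, Fin.sum_univ_four] using RingQuot.mkAlgHom_rel ℂ (relS.sum1 (q := q))

theorem facili_iff (q : ℝ) (hq0 : 0 < q) (hq1 : q < 1)
    [StarRing (AU q)] [StarModule ℂ (AU q)]
    (S : AU q →ₗ[ℂ] AU q)
    (hSanti : ∀ x y : AU q, S (x * y) = S y * S x) (hS1 : S 1 = 1)
    (hSleft : ∀ i j : Fin 4, ∑ k : Fin 4, S (tt q i k) * tt q k j = if i = j then 1 else 0)
    (hSright : ∀ i j : Fin 4, ∑ k : Fin 4, tt q i k * S (tt q k j) = if i = j then 1 else 0)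
    (hSD : S (Dq q) = dI q) (hSDi : S (dI q) = Dq q)
    (hstarT : ∀ i j : Fin 4, star (tt q i j) = S (tt q j i))
    (hstarD : star (Dq q) = dI q)
    [StarRing (PA q)] [StarModule ℂ (PA q)]
    (hstarz : ∀ i : Fin 4, star (z q i) = zs q i)
    (δ : PA q →ₐ[ℂ] PA q ⊗[ℂ] AU q)
    (hδz : ∀ i : Fin 4, δ (z q i) = ∑ j : Fin 4, z q j ⊗ₜ[ℂ] tt q j i)
    (hδzs : ∀ i : Fin 4, δ (zs q i) = ∑ j : Fin 4, zs q j ⊗ₜ[ℂ] star (tt q j i))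
    (k : ℤ) (hk : 0 ≤ k) (m n : ℕ) (x u v : PBP q δ)
    (hu : u = ((q : ℂ) ^ (2 + m + n)) • lact q δ (star (z q 0)) (ract q δ (z q 0) x)
        + ((q : ℂ) ^ (2 + m + n)) • lact q δ (z q 1) (ract q δ (star (z q 1)) x)
        + ((q : ℂ) ^ 2) • lact q δ (z q 2) (ract q δ (star (z q 2)) x)
        + lact q δ (star (z q 3)) (ract q δ (z q 3) x))
    (hv : v = -(((q : ℂ) ^ 3) • lact q δ (z q 0) (ract q δ (star (z q 1)) x))
        + ((q : ℂ) ^ 2) • lact q δ (star (z q 1)) (ract q δ (z q 0) x)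
        - ((q : ℂ) ^ k) • lact q δ (star (z q 2)) (ract q δ (z q 3) x)
        + ((q : ℂ) ^ (1 + k)) • lact q δ (z q 3) (ract q δ (star (z q 2)) x))
        : ((((q : ℂ) ^ (-((m : ℤ) + (n : ℤ)))) • lact q δ (z q 0) u + lact q δ (z q 1) v
        = ract q δ (z q 0) x) ∧
     (-(((q : ℂ) ^ (-k)) • lact q δ (z q 2) v) + lact q δ (z q 3) u = ract q δ (z q 3) x) ∧
     (-((q : ℂ) • lact q δ (star (z q 0)) v)
        + ((q : ℂ) ^ (-((m : ℤ) + (n : ℤ)))) • lact q δ (star (z q 1)) u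
        = ract q δ (star (z q 1)) x) ∧
     (lact q δ (star (z q 2)) u + ((q : ℂ) ^ (-(1 + k))) • lact q δ (star (z q 3)) v
        = ract q δ (star (z q 2)) x))
    ↔ ((lact q δ (1 - ((q : ℂ) ^ 2) • RRe q) (ract q δ (z q 0) x)
        = ((q : ℂ) ^ (2 - (m : ℤ) - (n : ℤ))) • lact q δ (bN q ((m : ℤ) + n + k)) (ract q δ (star (z q 2)) x)
          + ((q : ℂ) ^ (-((m : ℤ) + (n : ℤ)))) • lact q δ (aN q (k + (m : ℤ) + n)) (ract q δ (z q 3) x)) ∧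
     (lact q δ (RRe q) (ract q δ (z q 3) x)
        = ((q : ℂ) ^ (2 - k)) • lact q δ (bN q (k + (m : ℤ) + n)) (ract q δ (star (z q 1)) x)
          + ((q : ℂ) ^ (2 + (m : ℤ) + n)) • lact q δ (star (aN q (-((m : ℤ) + n + k)))) (ract q δ (z q 0) x)) ∧
     (lact q δ (1 - ((q : ℂ) ^ 2) • RRe q) (ract q δ (star (z q 1)) x)
        = ((q : ℂ) ^ k) • lact q δ (star (bN q (-((m : ℤ) + n + k)))) (ract q δ (z q 3) x)
          - ((q : ℂ) ^ (3 + k)) • lact q δ (star (aN q (-((m : ℤ) + n + k)))) (ract q δ (star (z q 2)) x)) ∧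
     (((q : ℂ) ^ 4) • lact q δ (RRe q) (ract q δ (star (z q 2)) x)
        = ((q : ℂ) ^ (2 + (m : ℤ) + n)) • lact q δ (star (bN q (-((m : ℤ) + n + k)))) (ract q δ (z q 0) x)
          - ((q : ℂ) ^ (3 - k)) • lact q δ (aN q (k + (m : ℤ) + n)) (ract q δ (star (z q 1)) x))) := by
  have hqc : (q : ℂ) ≠ 0 := by exact_mod_cast hq0.ne'
  subst hu hv
  simp only [hstarz, RRe, aN, bN, star_sub, star_add, star_mul, star_smul]
  have hss : ∀ i, star (zs q i) = z q i := fun i => by rw [← hstarz, star_star]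
  have hsc : ∀ n : ℤ, star ((q : ℂ) ^ n) = (q : ℂ) ^ n := fun n => by
    simp
  simp only [hstarz, hss, hsc]
  generalize ract q δ (z q 0) x = X1
  generalize ract q δ (zs q 1) x = X2
  generalize ract q δ (zs q 2) x = X3
  generalize ract q δ (z q 3) x = X4
  simp only [lactHom_apply]
  set L := lactHom q δ
  have f0 : Finset.univ.filter (· < (0 : Fin 4)) = ∅ := by decide
  have f1 : Finset.univ.filter (· < (1 : Fin 4)) = {0} := by decide
  have f2 : Finset.univ.filter (· < (2 : Fin 4)) = {0, 1} := by decide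
  have f3 : Finset.univ.filter (· < (3 : Fin 4)) = {0, 1, 2} := by decide
  have zz : ∀ i j : Fin 4, i < j → ∀ Y, L (z q i) (L (z q j) Y) =
      (q : ℂ) • L (z q j) (L (z q i) Y) := fun i j h Y => by
    simpa only [map_mul, map_smul, LinearMap.smul_apply, Module.End.mul_apply] using
      congrArg (fun a => L a Y) (z_zz q h)
  have ss : ∀ i j : Fin 4, i < j → ∀ Y, L (zs q j) (L (zs q i) Y) =
      (q : ℂ) • L (zs q i) (L (zs q j) Y) := fun i j h Y => by
    simpa only [map_mul, map_smul, LinearMap.smul_apply, Module.End.mul_apply] using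
      congrArg (fun a => L a Y) (z_ss q h)
  have sz : ∀ i j : Fin 4, i ≠ j → ∀ Y, L (zs q j) (L (z q i) Y) =
      (q : ℂ) • L (z q i) (L (zs q j) Y) := fun i j h Y => by
    simpa only [map_mul, map_smul, LinearMap.smul_apply, Module.End.mul_apply] using
      congrArg (fun a => L a Y) (z_sz q h)
  have s0 : ∀ Y, L (zs q 0) (L (z q 0) Y) = L (z q 0) (L (zs q 0) Y) := fun Y => by
    simpa [f0] using congrArg (fun a => L a Y) (z_szz q 0)
  have s1 : ∀ Y, L (zs q 1) (L (z q 1) Y) = L (z q 1) (L (zs q 1) Y)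
      + (1 - (q : ℂ) ^ 2) • L (z q 0) (L (zs q 0) Y) := fun Y => by
    have h := congrArg (fun a => L a Y) (z_szz q 1)
    rw [f1, Finset.sum_singleton] at h
    simpa only [map_add, map_smul, map_mul, LinearMap.add_apply, LinearMap.smul_apply,
      Module.End.mul_apply] using h
  have s2 : ∀ Y, L (zs q 2) (L (z q 2) Y) = L (z q 2) (L (zs q 2) Y)
      + (1 - (q : ℂ) ^ 2) • (L (z q 0) (L (zs q 0) Y) + L (z q 1) (L (zs q 1) Y)) := fun Y => by
    have h := congrArg (fun a => L a Y) (z_szz q 2)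
    rw [f2, Finset.sum_insert (by decide), Finset.sum_singleton] at h
    simpa only [map_add, map_smul, map_mul, LinearMap.add_apply, LinearMap.smul_apply,
      Module.End.mul_apply] using h
  have s3 : ∀ Y, L (zs q 3) (L (z q 3) Y) = L (z q 3) (L (zs q 3) Y)
      + (1 - (q : ℂ) ^ 2) • (L (z q 0) (L (zs q 0) Y) + (L (z q 1) (L (zs q 1) Y)
        + L (z q 2) (L (zs q 2) Y))) := fun Y => by
    have h := congrArg (fun a => L a Y) (z_szz q 3)
    rw [f3, Finset.sum_insert (by decide), Finset.sum_insert (by decide),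
      Finset.sum_singleton] at h
    simpa only [map_add, map_smul, map_mul, LinearMap.add_apply, LinearMap.smul_apply,
      Module.End.mul_apply] using h
  have sm : ∀ Y, L (z q 3) (L (zs q 3) Y) = Y - L (z q 0) (L (zs q 0) Y)
      - L (z q 1) (L (zs q 1) Y) - L (z q 2) (L (zs q 2) Y) := fun Y => by
    have h := congrArg (fun a => L a Y) (z_sum q)
    simp only [map_add, map_mul, map_one, LinearMap.add_apply,
      Module.End.mul_apply, Module.End.one_apply] at h
    linear_combination (norm := module) h
  simp only [map_add, map_sub, map_neg, map_smul, map_mul, map_one, LinearMap.add_apply,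
    LinearMap.sub_apply, LinearMap.smul_apply, Module.End.mul_apply, Module.End.one_apply,
    zz 0 1 (by decide), zz 0 2 (by decide), zz 1 3 (by decide), zz 2 3 (by decide),
    ss 0 1 (by decide), ss 0 2 (by decide), ss 1 3 (by decide), ss 2 3 (by decide),
    sz 3 0 (by decide), sz 0 3 (by decide), sz 2 1 (by decide), sz 1 2 (by decide),
    s0, s1, s2, s3, sm]
  have e1 : (q : ℂ) ^ (-((m : ℤ) + (n : ℤ))) = ((q : ℂ) ^ m)⁻¹ * ((q : ℂ) ^ n)⁻¹ := by
    rw [zpow_neg, zpow_add₀ hqc, mul_inv]; simp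
  have e2 : (q : ℂ) ^ (-k) = ((q : ℂ) ^ k)⁻¹ := zpow_neg _ _
  have e3 : (q : ℂ) ^ (-(1 + k)) = (q : ℂ)⁻¹ * ((q : ℂ) ^ k)⁻¹ := by
    rw [zpow_neg, zpow_add₀ hqc, mul_inv]; simp
  have e4 : (q : ℂ) ^ (1 + k) = q * (q : ℂ) ^ k := by rw [zpow_add₀ hqc]; simp
  have e5 : (q : ℂ) ^ (2 - (m : ℤ) - (n : ℤ)) = q ^ 2 * ((q : ℂ) ^ m)⁻¹ * ((q : ℂ) ^ n)⁻¹ := by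
    rw [zpow_sub₀ hqc, zpow_sub₀ hqc, div_eq_mul_inv, div_eq_mul_inv]; norm_cast
  have e6 : (q : ℂ) ^ ((m : ℤ) + n + k - 1) = q ^ m * q ^ n * q ^ k * (q : ℂ)⁻¹ := by
    rw [zpow_sub₀ hqc, zpow_add₀ hqc, zpow_add₀ hqc, div_eq_mul_inv]; simp
  have e7 : (q : ℂ) ^ (k + (m : ℤ) + n - 1) = q ^ m * q ^ n * q ^ k * (q : ℂ)⁻¹ := by
    rw [← e6]; congr 1; ring
  have e8 : (q : ℂ) ^ (k + (m : ℤ) + n) = q ^ m * q ^ n * q ^ k := by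
    rw [zpow_add₀ hqc, zpow_add₀ hqc]; simp; ring
  have e9 : (q : ℂ) ^ (-((m : ℤ) + n + k)) = ((q : ℂ) ^ m * (q : ℂ) ^ n * (q : ℂ) ^ k)⁻¹ := by
    rw [← e8, ← zpow_neg]; congr 1; ring
  have e10 : (q : ℂ) ^ (-((m : ℤ) + n + k) - 1) = ((q : ℂ) ^ m * (q : ℂ) ^ n * (q : ℂ) ^ k)⁻¹ * (q : ℂ)⁻¹ := by
    rw [zpow_sub₀ hqc, e9, div_eq_mul_inv]; simp
  have e11 : (q : ℂ) ^ (2 - k) = q ^ 2 * ((q : ℂ) ^ k)⁻¹ := by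
    rw [zpow_sub₀ hqc, div_eq_mul_inv]; norm_cast
  have e12 : (q : ℂ) ^ (3 - k) = q ^ 3 * ((q : ℂ) ^ k)⁻¹ := by
    rw [zpow_sub₀ hqc, div_eq_mul_inv]; norm_cast
  have e13 : (q : ℂ) ^ (3 + k) = q ^ 3 * (q : ℂ) ^ k := by
    rw [zpow_add₀ hqc]; norm_cast
  have e14 : (q : ℂ) ^ (2 + (m : ℤ) + n) = q ^ 2 * q ^ m * q ^ n := by
    rw [zpow_add₀ hqc, zpow_add₀ hqc]; norm_cast
  have e15 : (q : ℂ) ^ (2 + m + n) = q ^ 2 * q ^ m * q ^ n := by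
    rw [pow_add, pow_add]
  simp only [e1, e2, e3, e4, e5, e6, e7, e8, e9, e10, e11, e12, e13, e14, e15]
  have hK : (q : ℂ) ^ k ≠ 0 := zpow_ne_zero _ hqc
  have hM : (q : ℂ) ^ m ≠ 0 := pow_ne_zero _ hqc
  have hN : (q : ℂ) ^ n ≠ 0 := pow_ne_zero _ hqc
  clear e1 e2 e3 e4 e5 e6 e7 e8 e9 e10 e11 e12 e13 e14 e15
  generalize (q : ℂ) ^ k = K at *
  generalize (q : ℂ) ^ m = M at *
  generalize (q : ℂ) ^ n = N at *
  clear_value L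
  refine and_congr ?_ (and_congr ?_ (and_congr ?_ ?_))
  · constructor <;> intro h <;>
      linear_combination (norm := (match_scalars <;> (try field_simp) <;> ring)) -h
  · constructor <;> intro h <;>
      linear_combination (norm := (match_scalars <;> (try field_simp) <;> ring)) -h
  · constructor <;> intro h <;>
      linear_combination (norm := (match_scalars <;> (try field_simp) <;> ring)) -h
  · constructor <;> intro h <;>
      linear_combination (norm := (match_scalars <;> (try field_simp) <;> ring)) -h

end QIB
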